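/- Let Γ be an inverse semigroup with zero which is 0-E-unitary, and let x, y ∈ Γ have a common precessor z with z ≠ 0. Then w := x·y⁻¹·x satisfies w = y·x⁻¹·y, w ≺ x, w ≺ y, and every common precessor v of x and y satisfies v ≺ w; that is, w is the largest common precessor of x and y. -/

import Mathlib

/-- An inverse semigroup: a semigroup in which every element `x` has a unique
element `x⁻¹` with `x * x⁻¹ * x = x` and `x⁻¹ * x * x⁻¹ = x⁻¹`. -/
class InverseSemigroup (α : Type*) extends Semigroup α, Inv α where
  mul_inv_mul : ∀ x : α, x * x⁻¹ * x = x
  inv_mul_inv : ∀ x : α, x⁻¹ * x * x⁻¹ = x⁻¹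
  inv_unique : ∀ x y : α, x * y * x = x → y * x * y = y → y = x⁻¹

variable {α : Type*} [InverseSemigroup α]

/-- The natural order on an inverse semigroup: `x ≺ y` iff `x * y⁻¹ = x * x⁻¹`. -/
def prec (x y : α) : Prop := x * y⁻¹ = x * x⁻¹

/-- The idempotents (units) `Γ⁽⁰⁾`: elements `p` with `p = p * p⁻¹`. -/
def IsIdem (p : α) : Prop := p = p * p⁻¹

/-- A zero element: `z * x = z = x * z` for every `x`. -/
def IsZeroEl (z : α) : Prop := ∀ x : α, z * x = z ∧ x * z = z


namespace InverseSemigroup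

theorem inv_inv_eq (x : α) : x⁻¹⁻¹ = x :=
  (inv_unique _ _ (inv_mul_inv x) (mul_inv_mul x)).symm

theorem inv_eq_self_of_mul_self {e : α} (he : e * e = e) : e⁻¹ = e :=
  (inv_unique _ _ (by rw [he, he]) (by rw [he, he])).symm

theorem isIdem_iff_mul_self {e : α} : IsIdem e ↔ e * e = e := by
  refine ⟨fun h => ?_, fun h => ?_⟩
  · calc e * e = (e * e⁻¹) * e := by rw [← show e = e * e⁻¹ from h]
      _ = e := mul_inv_mul e
  · rw [IsIdem, inv_eq_self_of_mul_self h, h]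

theorem mul_inv_mul_self (x : α) : (x * x⁻¹) * (x * x⁻¹) = x * x⁻¹ := by
  rw [← mul_assoc, mul_inv_mul]

theorem inv_mul_mul_self (x : α) : (x⁻¹ * x) * (x⁻¹ * x) = x⁻¹ * x := by
  rw [← mul_assoc, inv_mul_inv]

theorem mul_idem_of_idem {e f : α} (he : e * e = e) (hf : f * f = f) :
    (e * f) * (e * f) = e * f := by
  have h1 := mul_inv_mul (e * f)
  have h2 := inv_mul_inv (e * f)
  have ha : f * (e * f)⁻¹ * e = (e * f)⁻¹ := by
    refine inv_unique _ _ ?_ ?_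
    · calc e * f * (f * (e * f)⁻¹ * e) * (e * f)
          = e * (f * f) * (e * f)⁻¹ * ((e * e) * f) := by simp only [mul_assoc]
        _ = e * f := by rw [he, hf, h1]
    · calc f * (e * f)⁻¹ * e * (e * f) * (f * (e * f)⁻¹ * e)
          = f * ((e * f)⁻¹ * ((e * e) * (f * f)) * (e * f)⁻¹) * e := by simp only [mul_assoc]
        _ = f * (e * f)⁻¹ * e := by rw [he, hf, h2]
  have haa : (e * f)⁻¹ * (e * f)⁻¹ = (e * f)⁻¹ := by
    calc (e * f)⁻¹ * (e * f)⁻¹ = (f * (e * f)⁻¹ * e) * (f * (e * f)⁻¹ * e) := by rw [ha]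
      _ = f * ((e * f)⁻¹ * (e * f) * (e * f)⁻¹) * e := by simp only [mul_assoc]
      _ = (e * f)⁻¹ := by rw [h2, ha]
  have h := inv_eq_self_of_mul_self haa
  rw [inv_inv_eq] at h
  rwa [← h] at haa

theorem idem_comm {e f : α} (he : e * e = e) (hf : f * f = f) : e * f = f * e := by
  have h1 := mul_idem_of_idem he hf
  have h2 := mul_idem_of_idem hf he
  have h : f * e = (e * f)⁻¹ := by
    refine inv_unique _ _ ?_ ?_
    · calc e * f * (f * e) * (e * f) = e * (f * f) * ((e * e) * f) := by simp only [mul_assoc]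
        _ = e * f := by rw [he, hf, h1]
    · calc f * e * (e * f) * (f * e) = f * (e * e) * ((f * f) * e) := by simp only [mul_assoc]
        _ = f * e := by rw [he, hf, h2]
  rw [h, inv_eq_self_of_mul_self h1]

theorem mul_inv_rev_eq (x y : α) : (x * y)⁻¹ = y⁻¹ * x⁻¹ := by
  have hc := idem_comm (inv_mul_mul_self x) (mul_inv_mul_self y)
  refine (inv_unique _ _ ?_ ?_).symm
  · calc x * y * (y⁻¹ * x⁻¹) * (x * y) = x * ((y * y⁻¹) * (x⁻¹ * x)) * y := by
          simp only [mul_assoc]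
      _ = (x * x⁻¹ * x) * (y * y⁻¹ * y) := by rw [← hc]; simp only [mul_assoc]
      _ = x * y := by rw [mul_inv_mul, mul_inv_mul]
  · calc y⁻¹ * x⁻¹ * (x * y) * (y⁻¹ * x⁻¹) = y⁻¹ * ((x⁻¹ * x) * (y * y⁻¹)) * x⁻¹ := by
          simp only [mul_assoc]
      _ = (y⁻¹ * y * y⁻¹) * (x⁻¹ * x * x⁻¹) := by rw [hc]; simp only [mul_assoc]
      _ = y⁻¹ * x⁻¹ := by rw [inv_mul_inv, inv_mul_inv]

theorem mul_inv_mul_of_prec {v y : α} (h : prec v y) : v * v⁻¹ * y = v := by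
  have h : v * y⁻¹ = v * v⁻¹ := h
  have h' : y * v⁻¹ = v * v⁻¹ := by
    simpa only [mul_inv_rev_eq, inv_inv_eq] using congrArg Inv.inv h
  have hv : y * (v⁻¹ * v) = v := by rw [← mul_assoc, h', mul_inv_mul]
  calc v * v⁻¹ * y = y * (v⁻¹ * v) * y⁻¹ * y := by rw [← h, hv]
    _ = y * ((v⁻¹ * v) * (y⁻¹ * y)) := by simp only [mul_assoc]
    _ = (y * y⁻¹ * y) * (v⁻¹ * v) := by
        rw [idem_comm (inv_mul_mul_self v) (inv_mul_mul_self y)]; simp only [mul_assoc]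
    _ = v := by rw [mul_inv_mul, hv]

theorem prec_inv {v y : α} (h : prec v y) : prec v⁻¹ y⁻¹ := by
  unfold prec
  rw [inv_inv_eq, inv_inv_eq]
  calc v⁻¹ * y = v⁻¹ * v * v⁻¹ * y := by rw [inv_mul_inv]
    _ = v⁻¹ * (v * v⁻¹ * y) := by simp only [mul_assoc]
    _ = v⁻¹ * v := by rw [mul_inv_mul_of_prec h]

theorem idem_mul_prec {e : α} (he : e * e = e) (x : α) : prec (e * x) x := by
  unfold prec
  calc e * x * x⁻¹ = (e * e) * (x * x⁻¹) := by rw [he, mul_assoc]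
    _ = e * x * (e * x)⁻¹ := by
        rw [mul_inv_rev_eq, inv_eq_self_of_mul_self he, mul_assoc e e,
          idem_comm he (mul_inv_mul_self x)]
        simp only [mul_assoc]

theorem mul_inv_prec_mul_inv {v x y : α} (hx : prec v x) (hy : prec v y) :
    prec (v * v⁻¹) (x * y⁻¹) := by
  have hx : v * x⁻¹ = v * v⁻¹ := hx
  unfold prec
  rw [mul_inv_rev_eq, inv_inv_eq, ← mul_assoc, mul_inv_mul_of_prec hy, hx,
    inv_eq_self_of_mul_self (mul_inv_mul_self v), mul_inv_mul_self]

theorem mul_inv_idem_of_common_prec {z : α} (hz : IsZeroEl z)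
    (hE : ∀ p y : α, IsIdem p → p ≠ z → prec p y → IsIdem y)
    {x y v : α} (hvx : prec v x) (hvy : prec v y) (hv : v ≠ z) :
    (x * y⁻¹) * (x * y⁻¹) = x * y⁻¹ := by
  refine isIdem_iff_mul_self.1 (hE _ _ (isIdem_iff_mul_self.2 (mul_inv_mul_self v)) ?_
    (mul_inv_prec_mul_inv hvx hvy))
  intro h
  apply hv
  rw [← mul_inv_mul v, h, (hz v).1]

end InverseSemigroup

open InverseSemigroup

/-- in a 0-E-unitary inverse semigroup with zero, if x and y have a
common precessor v ≠ 0 then w := x·y⁻¹·x equals y·x⁻¹·y and is the largest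
common precessor of x and y. -/
theorem stmt4 {z : α} (hz : IsZeroEl z)
    (hE : ∀ p y : α, IsIdem p → p ≠ z → prec p y → IsIdem y)
    {x y v : α} (hvx : prec v x) (hvy : prec v y) (hv : v ≠ z) :
    x * y⁻¹ * x = y * x⁻¹ * y ∧
    prec (x * y⁻¹ * x) x ∧ prec (x * y⁻¹ * x) y ∧
    ∀ w : α, prec w x → prec w y → prec w (x * y⁻¹ * x) := by
  have he := mul_inv_idem_of_common_prec hz hE hvx hvy hv
  have hv' : v⁻¹ ≠ z := by
    intro h
    apply hv
    rw [← mul_inv_mul v, h, (hz v).2, (hz v).1]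
  have hf := mul_inv_idem_of_common_prec hz hE (prec_inv hvx) (prec_inv hvy) hv'
  have he' := inv_eq_self_of_mul_self he
  have hf' := inv_eq_self_of_mul_self hf
  simp only [mul_inv_rev_eq, inv_inv_eq] at he' hf'
  have hw : x * y⁻¹ * x = y * x⁻¹ * y := by
    calc x * y⁻¹ * x = x * (y⁻¹ * y * y⁻¹) * x := by rw [inv_mul_inv]
      _ = (x * y⁻¹) * y * (y⁻¹ * x) := by simp only [mul_assoc]
      _ = (y * x⁻¹) * y * (x⁻¹ * y) := by rw [hf', he']
      _ = (y * x⁻¹) * (y * x⁻¹) * y := by simp only [mul_assoc]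
      _ = y * x⁻¹ * y := by rw [he', he]
  refine ⟨hw, idem_mul_prec he x, ?_, fun w hwx hwy => ?_⟩
  · rw [hw, he']
    exact idem_mul_prec he y
  · have hx : w * x⁻¹ = w * w⁻¹ := hwx
    have hy : w * y⁻¹ = w * w⁻¹ := hwy
    unfold prec
    rw [mul_inv_rev_eq, inv_eq_self_of_mul_self he, ← mul_assoc, hx, ← mul_assoc,
      mul_inv_mul_of_prec hwx, hy]
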